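/- Let d ≥ 2 and q satisfy d ≡ 2 (mod 4) and q ≡ 3 (mod 4). Then for every set A ⊆ F_q^d, one has (as an inequality of real numbers) SQ(A) ≤ |A|²/2 + q^{d/2}·|A|/2 − |A|²/(2q) − q^{(d−2)/2}·|A|/2. -/

import Mathlib

open Finset

/-- `‖x‖ = x₁² + ⋯ + x_d²` for `x ∈ F_q^d`. -/
def normSq {d : ℕ} {F : Type} [Field F] [Fintype F] (x : Fin d → F) : F := ∑ i, x i ^ 2

/-- `SQ(A)` : the number of pairs `(x,y) ∈ A×A` with `η(‖x−y‖) = 1`,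
where `η` is the quadratic character of `F` (with `η(0) = 0`). -/
noncomputable def SQpairs {d : ℕ} {F : Type} [Field F] [Fintype F] [DecidableEq F]
    (A : Finset (Fin d → F)) : ℕ :=
  ((A ×ˢ A).filter (fun p => quadraticChar F (normSq (p.1 - p.2)) = 1)).card


open AddChar

section ExponentialSums

variable {F : Type} [Field F] [Fintype F] [DecidableEq F]

/-- The quadratic character of a finite field, with complex values. -/
noncomputable def complexQuadraticChar (F : Type) [Field F] [Fintype F] [DecidableEq F] :
    MulChar F ℂ :=
  (quadraticChar F).ringHomComp (Int.castRingHom ℂ)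

lemma complexQuadraticChar_apply (a : F) :
    complexQuadraticChar F a = (quadraticChar F a : ℂ) := rfl

lemma complexQuadraticChar_isQuadratic : (complexQuadraticChar F).IsQuadratic :=
  MulChar.IsQuadratic.comp (quadraticChar_isQuadratic F) _

lemma complexQuadraticChar_ne_one (hF : ringChar F ≠ 2) : complexQuadraticChar F ≠ 1 := by
  intro h
  obtain ⟨a, ha⟩ := quadraticChar_exists_neg_one' hF
  have h1 := complexQuadraticChar_apply (a : F)
  rw [h, MulChar.one_apply_coe, ha] at h1
  norm_num at h1

lemma sum_comp_sq (hF : ringChar F ≠ 2) (g : F → ℂ) :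
    ∑ t, g (t ^ 2) = ∑ u, (1 + complexQuadraticChar F u) * g u := by
  rw [← Finset.sum_fiberwise_of_maps_to (s := univ) (t := univ) (g := fun t : F => t ^ 2)
    (fun _ _ => mem_univ _)]
  refine Finset.sum_congr rfl fun u _ => ?_
  have h := quadraticChar_card_sqrts hF u
  rw [Finset.sum_congr rfl (g := fun _ => g u) (by simp +contextual), Finset.sum_const,
    nsmul_eq_mul, complexQuadraticChar_apply]
  congr 1
  have h2 : ((#{x : F | x ^ 2 = u} : ℤ)) = quadraticChar F u + 1 := by
    rw [← h]; congr 2; ext; simp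
  have h3 := congrArg (Int.cast : ℤ → ℂ) h2
  push_cast at h3
  rw [h3, add_comm]

lemma sum_char_mul_addChar (hF : ringChar F ≠ 2) (ψ : AddChar F ℂ) (a : F) :
    ∑ u, complexQuadraticChar F u * ψ (a * u) =
      complexQuadraticChar F a * gaussSum (complexQuadraticChar F) ψ := by
  by_cases ha : a = 0
  · simp [ha, MulChar.map_zero, MulChar.sum_eq_zero_of_ne_one (complexQuadraticChar_ne_one hF)]
  · have h := gaussSum_mulShift_eq (complexQuadraticChar F) ψ (Units.mk0 a ha)
    rw [complexQuadraticChar_isQuadratic.inv] at h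
    simpa [gaussSum, mulShift_apply] using h

lemma sum_addChar_mul_sq (hF : ringChar F ≠ 2) {ψ : AddChar F ℂ} (hψ : ψ.IsPrimitive)
    {s : F} (hs : s ≠ 0) :
    ∑ t, ψ (s * t ^ 2) = complexQuadraticChar F s * gaussSum (complexQuadraticChar F) ψ := by
  rw [sum_comp_sq hF fun u => ψ (s * u)]
  simp_rw [add_mul, one_mul, Finset.sum_add_distrib, sum_char_mul_addChar hF, mul_comm s,
    sum_mulShift s hψ]
  simp [hs]

omit [Fintype F] [DecidableEq F] in
lemma four_ne_zero_of_ringChar_ne_two (hF : ringChar F ≠ 2) : (4 : F) ≠ 0 := by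
  have h2 := Ring.two_ne_zero hF
  rw [show (4 : F) = 2 * 2 by norm_num]
  exact mul_ne_zero h2 h2

lemma sum_addChar_quadratic (hF : ringChar F ≠ 2) {ψ : AddChar F ℂ} (hψ : ψ.IsPrimitive)
    {s : F} (hs : s ≠ 0) (w : F) :
    ∑ t, ψ (s * t ^ 2 + t * w) =
      complexQuadraticChar F s * gaussSum (complexQuadraticChar F) ψ *
        ψ ((-4 * s)⁻¹ * w ^ 2) := by
  have h2 : (2 : F) ≠ 0 := Ring.two_ne_zero hF
  rw [← sum_addChar_mul_sq hF hψ hs, Finset.sum_mul]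
  refine Fintype.sum_equiv (Equiv.addRight (w / (2 * s))) _ _ fun t => ?_
  rw [← map_add_eq_mul, Equiv.coe_addRight]
  congr 1
  have : (-4 * s)⁻¹ = -(2 * s)⁻¹ * 2⁻¹ := by
    rw [← inv_neg, ← mul_inv]
    congr 1
    ring
  rw [this]
  field_simp
  ring

omit [Fintype F] [DecidableEq F] in
lemma prod_addChar {d : ℕ} (ψ : AddChar F ℂ) (f : Fin d → F) :
    ∏ i, ψ (f i) = ψ (∑ i, f i) :=
  (map_prod ψ.toMonoidHom (fun i => Multiplicative.ofAdd (f i)) univ).symm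

lemma sum_addChar_normSq {d : ℕ} (hF : ringChar F ≠ 2) {ψ : AddChar F ℂ} (hψ : ψ.IsPrimitive)
    {s : F} (hs : s ≠ 0) (z : Fin d → F) :
    ∑ m : Fin d → F, ψ (s * normSq m + m ⬝ᵥ z) =
      (complexQuadraticChar F s * gaussSum (complexQuadraticChar F) ψ) ^ d *
        ψ ((-4 * s)⁻¹ * normSq z) := by
  have key : ∏ i, ∑ t, ψ (s * t ^ 2 + t * z i) =
      ∑ m : Fin d → F, ∏ i, ψ (s * m i ^ 2 + m i * z i) := by
    rw [Finset.prod_univ_sum, Fintype.piFinset_univ]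
  have h := prod_addChar (d := d) ψ
  simp_rw [h, sum_addChar_quadratic hF hψ hs, Finset.prod_mul_distrib, h] at key
  simp only [Finset.prod_const, Finset.card_univ, Fintype.card_fin] at key
  simp only [normSq, dotProduct, Finset.mul_sum, ← Finset.sum_add_distrib]
  rw [← key, mul_pow]

lemma sum_addChar_dotProduct {d : ℕ} {ψ : AddChar F ℂ} (hψ : ψ.IsPrimitive) (z : Fin d → F) :
    ∑ m : Fin d → F, ψ (m ⬝ᵥ z) = if z = 0 then (Fintype.card F : ℂ) ^ d else 0 := by
  have key : ∏ i, ∑ t, ψ (t * z i) = ∑ m : Fin d → F, ∏ i, ψ (m i * z i) := by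
    rw [Finset.prod_univ_sum, Fintype.piFinset_univ]
  have h := prod_addChar (d := d) ψ
  simp_rw [h, sum_mulShift _ hψ] at key
  simp only [dotProduct]
  rw [← key]
  split_ifs with hz
  · simp [hz]
  · obtain ⟨i, hi⟩ := Function.ne_iff.1 hz
    exact Finset.prod_eq_zero (mem_univ i) (by simpa using hi)

/-- The bijection `s ↦ (-4s)⁻¹` of `F`, sending `0` to `0`. -/
noncomputable def invNegFourMul (hF : ringChar F ≠ 2) : F ≃ F :=
  (Equiv.mulLeft₀ (-4 : F) (neg_ne_zero.2 (four_ne_zero_of_ringChar_ne_two hF))).trans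
    (Equiv.inv F)

omit [Fintype F] [DecidableEq F] in
lemma invNegFourMul_apply (hF : ringChar F ≠ 2) (s : F) :
    invNegFourMul hF s = (-4 * s)⁻¹ := rfl

lemma complexQuadraticChar_neg_one (hq : Fintype.card F % 4 = 3) (hF : ringChar F ≠ 2) :
    complexQuadraticChar F (-1) = -1 := by
  rw [complexQuadraticChar_apply, quadraticChar_neg_one hF, ZMod.χ₄_nat_three_mod_four hq]
  simp

lemma complexQuadraticChar_eq_neg (hq : Fintype.card F % 4 = 3) (hF : ringChar F ≠ 2) (s : F) :
    complexQuadraticChar F s = -complexQuadraticChar F (-4 * s)⁻¹ := by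
  have h2 := Ring.two_ne_zero hF
  have h4 : complexQuadraticChar F 4 = 1 := by
    rw [complexQuadraticChar_apply, show (4 : F) = 2 ^ 2 by norm_num, quadraticChar_sq_one' h2]
    simp
  have hinv (a : F) : complexQuadraticChar F a⁻¹ = complexQuadraticChar F a := by
    rw [← MulChar.inv_apply', complexQuadraticChar_isQuadratic.inv]
  rw [hinv, show -4 * s = (-1) * (4 * s) by ring, map_mul, map_mul, h4,
    complexQuadraticChar_neg_one hq hF]
  ring

lemma complexQuadraticChar_sq {s : F} (hs : s ≠ 0) : complexQuadraticChar F s ^ 2 = 1 := by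
  rw [complexQuadraticChar_apply]
  exact_mod_cast congrArg (Int.cast : ℤ → ℂ) (quadraticChar_sq_one hs)

section Kernel

variable {d k : ℕ} (hq : Fintype.card F % 4 = 3) (hF : ringChar F ≠ 2)
  {ψ : AddChar F ℂ} (hψ : ψ.IsPrimitive) (hk : Odd k) (hd : d = 2 * k)
include hq hF hψ hk hd

lemma sum_addChar_normSq_of_odd_half (s : F) (z : Fin d → F) :
    ∑ m : Fin d → F, ψ (s * normSq m + m ⬝ᵥ z) =
      -(Fintype.card F : ℂ) ^ k * ψ ((-4 * s)⁻¹ * normSq z) +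
        if s = 0 then (if z = 0 then (Fintype.card F : ℂ) ^ d else 0) + (Fintype.card F : ℂ) ^ k
        else 0 := by
  by_cases hs : s = 0
  · simp [hs, sum_addChar_dotProduct hψ]
  · have h : (complexQuadraticChar F s * gaussSum (complexQuadraticChar F) ψ) ^ d =
        -(Fintype.card F : ℂ) ^ k := by
      rw [hd, pow_mul, mul_pow, complexQuadraticChar_sq hs,
        gaussSum_sq (complexQuadraticChar_ne_one hF) complexQuadraticChar_isQuadratic hψ,
        complexQuadraticChar_neg_one hq hF, one_mul, neg_one_mul, hk.neg_pow]
    rw [sum_addChar_normSq hF hψ hs, h, if_neg hs, add_zero]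

lemma sum_addChar_dotProduct_of_normSq_eq_zero (z : Fin d → F) :
    Fintype.card F * ∑ m : Fin d → F, (if normSq m = 0 then 1 else 0) * ψ (m ⬝ᵥ z) =
      -(Fintype.card F : ℂ) ^ k * (if normSq z = 0 then (Fintype.card F : ℂ) else 0) +
        (if z = 0 then (Fintype.card F : ℂ) ^ d else 0) + (Fintype.card F : ℂ) ^ k := by
  have h1 : ∑ s : F, ψ ((-4 * s)⁻¹ * normSq z) =
      if normSq z = 0 then (Fintype.card F : ℂ) else 0 := by
    rw [Fintype.sum_equiv (invNegFourMul hF) (fun s => ψ ((-4 * s)⁻¹ * normSq z))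
      (fun u => ψ (u * normSq z)) fun s => rfl, sum_mulShift _ hψ]
    split_ifs <;> simp
  have h2 := Finset.sum_congr rfl fun s (_ : s ∈ univ) =>
    sum_addChar_normSq_of_odd_half hq hF hψ hk hd s z
  rw [Finset.sum_comm, Finset.sum_add_distrib, ← Finset.mul_sum, h1, Finset.sum_ite_eq' univ,
    if_pos (mem_univ _), ← add_assoc] at h2
  rw [← h2, Finset.mul_sum]
  refine Finset.sum_congr rfl fun m _ => ?_
  simp_rw [map_add_eq_mul, ← Finset.sum_mul, sum_mulShift _ hψ]
  split_ifs <;> simp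

lemma sum_char_normSq_mul_addChar (z : Fin d → F) :
    ∑ m : Fin d → F, complexQuadraticChar F (normSq m) * ψ (m ⬝ᵥ z) =
      (Fintype.card F : ℂ) ^ k * complexQuadraticChar F (normSq z) := by
  have hG : gaussSum (complexQuadraticChar F) ψ ≠ 0 := by
    intro h
    have := gaussSum_sq (complexQuadraticChar_ne_one hF) complexQuadraticChar_isQuadratic hψ
    rw [h, complexQuadraticChar_neg_one hq hF] at this
    simp at this
  apply mul_right_cancel₀ hG
  have h1 : ∑ s : F, complexQuadraticChar F s * ψ ((-4 * s)⁻¹ * normSq z) =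
      -(complexQuadraticChar F (normSq z) * gaussSum (complexQuadraticChar F) ψ) := by
    rw [← sum_char_mul_addChar hF, ← Finset.sum_neg_distrib]
    refine Fintype.sum_equiv (invNegFourMul hF) _ _ fun s => ?_
    rw [invNegFourMul_apply, complexQuadraticChar_eq_neg hq hF s, mul_comm (normSq z)]
    ring
  have h2 := Finset.sum_congr rfl fun s (_ : s ∈ univ) =>
    congrArg (complexQuadraticChar F s * ·) (sum_addChar_normSq_of_odd_half hq hF hψ hk hd s z)
  simp only [mul_add, Finset.sum_add_distrib, mul_ite, mul_zero] at h2
  simp_rw [mul_left_comm (complexQuadraticChar F _) (-(Fintype.card F : ℂ) ^ k)] at h2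
  rw [← Finset.mul_sum, h1, Finset.sum_ite_eq' univ] at h2
  simp only [mem_univ, MulChar.map_zero, zero_mul, ite_self, add_zero] at h2
  rw [neg_mul_neg] at h2
  rw [mul_assoc, ← h2, Finset.sum_mul]
  simp_rw [Finset.mul_sum]
  rw [Finset.sum_comm]
  refine Finset.sum_congr rfl fun m _ => ?_
  rw [mul_right_comm, ← sum_char_mul_addChar hF, Finset.sum_mul]
  refine Finset.sum_congr rfl fun s _ => ?_
  rw [map_add_eq_mul, mul_comm s]
  ring

/-- The Fourier transform of the indicator of `η(‖m‖) = -1`. -/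
lemma sum_addChar_dotProduct_of_nonsquare (z : Fin d → F) :
    2 * Fintype.card F *
        ∑ m : Fin d → F with quadraticChar F (normSq m) = -1, ψ (m ⬝ᵥ z) =
      (if z = 0 then ((Fintype.card F : ℂ) - 1) * (Fintype.card F : ℂ) ^ d else 0) -
        (Fintype.card F : ℂ) ^ k + (Fintype.card F : ℂ) ^ (k + 1) *
          (1 - 2 * if quadraticChar F (normSq z) = 1 then 1 else 0) := by
  have hchar (a : F) : (1 : ℂ) - (if a = 0 then 1 else 0) - complexQuadraticChar F a =
      2 * if quadraticChar F a = -1 then 1 else 0 := by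
    rw [complexQuadraticChar_apply]
    by_cases ha : a = 0
    · simp [ha]
    · rcases quadraticChar_dichotomy ha with h | h <;> norm_num [h, ha]
  have hchar' (a : F) : (if a = 0 then 1 else 0) - complexQuadraticChar F a =
      1 - 2 * if quadraticChar F a = 1 then 1 else 0 := by
    rw [complexQuadraticChar_apply]
    by_cases ha : a = 0
    · simp [ha]
    · rcases quadraticChar_dichotomy ha with h | h <;> norm_num [h, ha]
  have h1 := sum_addChar_dotProduct hψ z
  have h2 := sum_addChar_dotProduct_of_normSq_eq_zero hq hF hψ hk hd z
  have h3 := sum_char_normSq_mul_addChar hq hF hψ hk hd z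
  have h4 : 2 * ∑ m : Fin d → F with quadraticChar F (normSq m) = -1, ψ (m ⬝ᵥ z) =
      ∑ m : Fin d → F, ψ (m ⬝ᵥ z) -
        ∑ m : Fin d → F, (if normSq m = 0 then 1 else 0) * ψ (m ⬝ᵥ z) -
        ∑ m : Fin d → F, complexQuadraticChar F (normSq m) * ψ (m ⬝ᵥ z) := by
    rw [Finset.sum_filter, Finset.mul_sum, ← Finset.sum_sub_distrib, ← Finset.sum_sub_distrib]
    refine Finset.sum_congr rfl fun m _ => ?_
    rw [← sub_eq_zero]
    have := hchar (normSq m)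
    split_ifs at this ⊢ <;> linear_combination (-ψ (m ⬝ᵥ z)) * this
  rw [← hchar', mul_right_comm, h4, sub_mul, sub_mul, mul_comm _ (Fintype.card F : ℂ),
    mul_comm _ (Fintype.card F : ℂ), mul_comm _ (Fintype.card F : ℂ), h1, h2, h3]
  split_ifs <;> ring

end Kernel

omit [DecidableEq F] in
lemma sum_sum_addChar_dotProduct_sub {d : ℕ} (ψ : AddChar F ℂ) (A : Finset (Fin d → F))
    (m : Fin d → F) :
    ∑ p ∈ A ×ˢ A, ψ (m ⬝ᵥ (p.1 - p.2)) = (Complex.normSq (∑ x ∈ A, ψ (m ⬝ᵥ x)) : ℂ) := by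
  have hR : 0 < ringChar F := Nat.pos_of_ne_zero (CharP.ringChar_ne_zero_of_finite F)
  rw [← Complex.mul_conj, map_sum, Finset.sum_mul_sum, Finset.sum_product]
  refine Finset.sum_congr rfl fun x _ => Finset.sum_congr rfl fun y _ => ?_
  rw [starComp_apply hR, inv_apply, ← map_add_eq_mul, dotProduct_sub, sub_eq_add_neg]

end ExponentialSums

theorem square_distances_d2q3 (q d : ℕ) (F : Type) [Field F] [Fintype F] [DecidableEq F]
    (hcard : Fintype.card F = q) (hodd : Odd q)
    (hd : d % 4 = 2) (hq : q % 4 = 3) (hd2 : 2 ≤ d)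
    (A : Finset (Fin d → F)) :
    (SQpairs A : ℝ) ≤ (A.card : ℝ) ^ 2 / 2 + (q : ℝ) ^ (d / 2) * (A.card : ℝ) / 2 - (A.card : ℝ) ^ 2 / (2 * q)
      - (q : ℝ) ^ ((d - 2) / 2) * (A.card : ℝ) / 2 := by
  subst hcard
  have hF : ringChar F ≠ 2 := by
    intro h
    have := FiniteField.even_card_iff_char_two.1 h
    omega
  obtain ⟨j, rfl⟩ : ∃ j, d = 2 * (2 * j + 1) := ⟨d / 4, by omega⟩
  have hψ : ∃ ψ : AddChar F ℂ, ψ.IsPrimitive :=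
    ⟨_, FiniteField.primitiveChar_to_Complex_isPrimitive F⟩
  obtain ⟨ψ, hψ⟩ := hψ
  set q := Fintype.card F
  have hq0 : (0 : ℝ) < q := by exact_mod_cast Fintype.card_pos
  set T : ℝ := ∑ m : Fin (2 * (2 * j + 1)) → F with quadraticChar F (normSq m) = -1,
    Complex.normSq (∑ x ∈ A, ψ (m ⬝ᵥ x)) with hT
  have hT0 : 0 ≤ T := Finset.sum_nonneg fun m _ => Complex.normSq_nonneg _
  have hdiag : ∑ p ∈ A ×ˢ A, (if p.1 - p.2 = 0 then
      ((q : ℂ) - 1) * (q : ℂ) ^ (2 * (2 * j + 1)) else 0) =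
      (#A : ℂ) * (((q : ℂ) - 1) * (q : ℂ) ^ (2 * (2 * j + 1))) := by
    simp [Finset.sum_product, sub_eq_zero]
  have key : 2 * (q : ℂ) * T = (#A : ℂ) * (((q : ℂ) - 1) * (q : ℂ) ^ (2 * (2 * j + 1))) -
      (#A : ℂ) ^ 2 * (q : ℂ) ^ (2 * j + 1) +
      (q : ℂ) ^ (2 * j + 2) * ((#A : ℂ) ^ 2 - 2 * SQpairs A) := by
    have h := Finset.sum_congr rfl fun p (_ : p ∈ A ×ˢ A) =>
      sum_addChar_dotProduct_of_nonsquare hq hF hψ (odd_two_mul_add_one j) rfl (p.1 - p.2)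
    rw [← Finset.mul_sum, Finset.sum_comm] at h
    simp_rw [sum_sum_addChar_dotProduct_sub] at h
    rw [hT, Complex.ofReal_sum, h, Finset.sum_add_distrib, Finset.sum_sub_distrib, hdiag,
      ← Finset.mul_sum, Finset.sum_sub_distrib, ← Finset.mul_sum, Finset.sum_boole,
      Finset.sum_const, Finset.sum_const, Finset.card_product, SQpairs]
    simp only [nsmul_eq_mul, Nat.cast_mul]
    ring
  have keyR : 2 * (q : ℝ) * T = (#A : ℝ) * (((q : ℝ) - 1) * (q : ℝ) ^ (2 * (2 * j + 1))) -
      (#A : ℝ) ^ 2 * (q : ℝ) ^ (2 * j + 1) +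
      (q : ℝ) ^ (2 * j + 2) * ((#A : ℝ) ^ 2 - 2 * SQpairs A) := by
    exact_mod_cast key
  rw [show 2 * (2 * j + 1) / 2 = 2 * j + 1 by omega,
    show (2 * (2 * j + 1) - 2) / 2 = 2 * j by omega, ← sub_nonneg]
  have hpos : (0 : ℝ) < 2 * (q : ℝ) ^ (2 * j + 2) := by positivity
  refine nonneg_of_mul_nonneg_right (a := 2 * (q : ℝ) ^ (2 * j + 2)) ?_ hpos
  convert (mul_nonneg (by positivity) hT0 : 0 ≤ 2 * (q : ℝ) * T) using 1
  rw [keyR]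
  field_simp
  ring
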